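/- Let P ⊆ ℝ² be an unbounded convex polygon with nonparallel unbounded edges. Then the interior Int(P) is the image of a polynomial map f : ℝ³ → ℝ². -/

import Mathlib

/-- A polynomial map `ℝ³ → ℝ²`: both coordinate functions are given by real
polynomials in three variables. -/
def IsPolyMap3 (f : ℝ × ℝ × ℝ → ℝ × ℝ) : Prop :=
  ∃ p q : MvPolynomial (Fin 3) ℝ, ∀ v : ℝ × ℝ × ℝ,
    f v = (MvPolynomial.eval ![v.1, v.2.1, v.2.2] p,
           MvPolynomial.eval ![v.1, v.2.1, v.2.2] q)

/-- The recession cone of a planar set. -/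
def recessionCone (P : Set (ℝ × ℝ)) : Set (ℝ × ℝ) :=
  {d | ∀ p ∈ P, ∀ t : ℝ, 0 ≤ t → p + t • d ∈ P}

/-- A `V`-polygon: an unbounded convex polygon (finite intersection of closed
half-planes with nonempty interior) whose two unbounded edges are nonparallel,
i.e. whose recession cone is spanned by two linearly independent vectors. -/
def IsVPolygon (P : Set (ℝ × ℝ)) : Prop :=
  (∃ (n : ℕ) (a b c : Fin n → ℝ), (∀ i, (a i, b i) ≠ (0, 0)) ∧
    P = {p : ℝ × ℝ | ∀ i, 0 ≤ a i * p.1 + b i * p.2 + c i}) ∧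
  (interior P).Nonempty ∧
  ∃ v w : ℝ × ℝ, LinearIndependent ℝ ![v, w] ∧
    recessionCone P = {d | ∃ s t : ℝ, 0 ≤ s ∧ 0 ≤ t ∧ d = s • v + t • w}

/-- Real functions of three variables given by a polynomial. -/
def IsPolyFun3 (g : ℝ × ℝ × ℝ → ℝ) : Prop :=
  ∃ p : MvPolynomial (Fin 3) ℝ, ∀ v, g v = MvPolynomial.eval ![v.1, v.2.1, v.2.2] p

namespace IsPolyFun3

theorem const (c : ℝ) : IsPolyFun3 fun _ => c := ⟨MvPolynomial.C c, by simp⟩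

theorem fst : IsPolyFun3 fun v => v.1 := ⟨MvPolynomial.X 0, by simp⟩

theorem snd : IsPolyFun3 fun v => v.2.1 := ⟨MvPolynomial.X 1, by simp⟩

theorem trd : IsPolyFun3 fun v => v.2.2 := ⟨MvPolynomial.X 2, by simp⟩

variable {g h : ℝ × ℝ × ℝ → ℝ}

theorem add (hg : IsPolyFun3 g) (hh : IsPolyFun3 h) : IsPolyFun3 fun v => g v + h v := by
  obtain ⟨p, hp⟩ := hg
  obtain ⟨q, hq⟩ := hh
  exact ⟨p + q, fun v => by simp [hp, hq]⟩

theorem sub (hg : IsPolyFun3 g) (hh : IsPolyFun3 h) : IsPolyFun3 fun v => g v - h v := by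
  obtain ⟨p, hp⟩ := hg
  obtain ⟨q, hq⟩ := hh
  exact ⟨p - q, fun v => by simp [hp, hq]⟩

theorem mul (hg : IsPolyFun3 g) (hh : IsPolyFun3 h) : IsPolyFun3 fun v => g v * h v := by
  obtain ⟨p, hp⟩ := hg
  obtain ⟨q, hq⟩ := hh
  exact ⟨p * q, fun v => by simp [hp, hq]⟩

theorem pow (hg : IsPolyFun3 g) (n : ℕ) : IsPolyFun3 fun v => g v ^ n := by
  obtain ⟨p, hp⟩ := hg
  exact ⟨p ^ n, fun v => by simp [hp]⟩

theorem sum {κ : Type*} (s : Finset κ) {G : κ → ℝ × ℝ × ℝ → ℝ} (hG : ∀ k, IsPolyFun3 (G k)) :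
    IsPolyFun3 fun v => ∑ k ∈ s, G k v := by
  choose p hp using hG
  exact ⟨∑ k ∈ s, p k, fun v => by simp [hp]⟩

theorem prod {κ : Type*} (s : Finset κ) {G : κ → ℝ × ℝ × ℝ → ℝ} (hG : ∀ k, IsPolyFun3 (G k)) :
    IsPolyFun3 fun v => ∏ k ∈ s, G k v := by
  choose p hp using hG
  exact ⟨∏ k ∈ s, p k, fun v => by simp [hp]⟩

theorem isPolyMap3 (hg : IsPolyFun3 g) (hh : IsPolyFun3 h) :
    IsPolyMap3 fun v => (g v, h v) := by
  obtain ⟨p, hp⟩ := hg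
  obtain ⟨q, hq⟩ := hh
  exact ⟨p, q, fun v => by simp [hp, hq]⟩

end IsPolyFun3

theorem IsPolyMap3.isPolyFun3_fst {f : ℝ × ℝ × ℝ → ℝ × ℝ} (hf : IsPolyMap3 f) :
    IsPolyFun3 fun v => (f v).1 := by
  obtain ⟨p, q, h⟩ := hf
  exact ⟨p, fun v => congrArg Prod.fst (h v)⟩

theorem IsPolyMap3.isPolyFun3_snd {f : ℝ × ℝ × ℝ → ℝ × ℝ} (hf : IsPolyMap3 f) :
    IsPolyFun3 fun v => (f v).2 := by
  obtain ⟨p, q, h⟩ := hf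
  exact ⟨q, fun v => congrArg Prod.snd (h v)⟩

/-- A polynomial in `x` whose values are exactly the reals `≥ 1 / (1 + E)`, when `E > 0`. -/
def recipBound (E x : ℝ) : ℝ := (1 - x * E) ^ 2 + x ^ 2 * E

theorem recipBound_mul (E x : ℝ) :
    recipBound E x * (1 + E) = 1 + E * (1 - x * (1 + E)) ^ 2 := by
  unfold recipBound; ring

theorem one_le_recipBound_mul {E : ℝ} (hE : 0 ≤ E) (x : ℝ) : 1 ≤ recipBound E x * (1 + E) := by
  rw [recipBound_mul]
  have := mul_nonneg hE (sq_nonneg (1 - x * (1 + E)))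
  linarith

theorem exists_recipBound_eq {E ρ : ℝ} (hE : 0 < E) (hρ : 1 ≤ ρ * (1 + E)) :
    ∃ x, recipBound E x = ρ := by
  have h1 : (1 + E) ≠ 0 := by positivity
  refine ⟨(1 + √((ρ * (1 + E) - 1) / E)) / (1 + E), mul_right_cancel₀ h1 ?_⟩
  rw [recipBound_mul, div_mul_cancel₀ _ h1]
  have h2 : (1 - (1 + √((ρ * (1 + E) - 1) / E))) ^ 2 = (ρ * (1 + E) - 1) / E := by
    rw [sub_add_cancel_left, neg_sq, Real.sq_sqrt]
    exact div_nonneg (by linarith) hE.le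
  rw [h2]
  field_simp
  ring

theorem IsPolyFun3.recipBound {g h : ℝ × ℝ × ℝ → ℝ} (hg : IsPolyFun3 g) (hh : IsPolyFun3 h) :
    IsPolyFun3 fun v => recipBound (g v) (h v) :=
  (((const 1).sub (hh.mul hg)).pow 2).add ((hh.pow 2).mul hg)

theorem exists_isPolyMap3_range_quadrant :
    ∃ f, IsPolyMap3 f ∧ Set.range f = {p : ℝ × ℝ | 0 < p.1 ∧ 0 < p.2} := by
  have hE : IsPolyFun3 fun v => 1 + v.1 ^ 2 :=
    (IsPolyFun3.const 1).add (IsPolyFun3.fst.pow 2)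
  refine ⟨fun v => (recipBound (1 + v.1 ^ 2) v.2.1, recipBound (1 + v.1 ^ 2) v.2.2),
    (hE.recipBound IsPolyFun3.snd).isPolyMap3 (hE.recipBound IsPolyFun3.trd), ?_⟩
  ext ⟨a, b⟩
  constructor
  · rintro ⟨v, hv⟩
    have pos : ∀ x, 0 < recipBound (1 + v.1 ^ 2) x := fun x =>
      pos_of_mul_pos_left
        (one_pos.trans_le (one_le_recipBound_mul (by positivity) x)) (by positivity)
    obtain ⟨rfl, rfl⟩ := Prod.mk.inj hv
    exact ⟨pos _, pos _⟩
  · rintro ⟨ha, hb⟩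
    simp only at ha hb
    have key : ∀ c : ℝ, 0 < c → 1 / c ≤ 1 / a + 1 / b →
        1 ≤ c * (1 + (1 + (1 / a + 1 / b) ^ 2)) := by
      intro c hc h
      rw [div_le_iff₀ hc] at h
      nlinarith [sq_nonneg (1 / a + 1 / b - 1)]
    obtain ⟨x, hx⟩ := exists_recipBound_eq (E := 1 + (1 / a + 1 / b) ^ 2) (by positivity)
      (key a ha (by have := one_div_pos.2 hb; linarith))
    obtain ⟨y, hy⟩ := exists_recipBound_eq (E := 1 + (1 / a + 1 / b) ^ 2) (by positivity)
      (key b hb (by have := one_div_pos.2 ha; linarith))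
    exact ⟨(1 / a + 1 / b, x, y), by simp only [hx, hy]⟩

/-- The ratio of two consecutive weights. -/
def weightRatio (n : ℕ) (s t : ℝ) (k : ℕ) : ℝ := s ^ 2 * t ^ (2 * (n - k))

/-- Log-concave polynomial weights: for large `t`, at most two consecutive ones among the first
`n + 1` are not negligible. -/
def weight (n : ℕ) (s t : ℝ) (j : ℕ) : ℝ := t ^ 2 * ∏ k ∈ Finset.range j, weightRatio n s t k

theorem weightRatio_nonneg (n : ℕ) (s t : ℝ) (k : ℕ) : 0 ≤ weightRatio n s t k := by
  unfold weightRatio; rw [pow_mul]; positivity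

theorem weight_nonneg (n : ℕ) (s t : ℝ) (j : ℕ) : 0 ≤ weight n s t j :=
  mul_nonneg (sq_nonneg t) (Finset.prod_nonneg fun k _ => weightRatio_nonneg n s t k)

theorem weight_zero (n : ℕ) (s t : ℝ) : weight n s t 0 = t ^ 2 := by simp [weight]

theorem weight_succ (n : ℕ) (s t : ℝ) (j : ℕ) :
    weight n s t (j + 1) = weight n s t j * weightRatio n s t j := by
  simp [weight, Finset.prod_range_succ, mul_assoc]

theorem weightRatio_eq {n k : ℕ} (hk : k < n) (s t : ℝ) :
    weightRatio n s t k = t ^ 2 * weightRatio n s t (k + 1) := by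
  unfold weightRatio
  rw [show 2 * (n - k) = 2 + 2 * (n - (k + 1)) by omega, pow_add]
  ring

theorem weightRatio_antitone (n : ℕ) (s : ℝ) {t : ℝ} (ht : 1 ≤ t) :
    Antitone (weightRatio n s t) := by
  intro a b hab
  unfold weightRatio
  gcongr

theorem exists_weight_dominant {n : ℕ} (hn : 0 < n) (s : ℝ) {t : ℝ} (ht : 1 ≤ t) :
    ∃ e < n, ∀ j ≤ n, j ≠ e → j ≠ e + 1 →
      t * weight n s t j ≤ weight n s t e + weight n s t (e + 1) := by
  classical
  have hex : ∃ e, n ≤ e + 1 ∨ t * weightRatio n s t (e + 1) ≤ 1 := ⟨n, Or.inl (by omega)⟩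
  have hw := weight_nonneg n s t
  have hle : Nat.find hex ≤ n - 1 := Nat.find_min' hex (Or.inl (by omega))
  have hmin := fun m => @Nat.find_min _ _ hex m
  have hspec := Nat.find_spec hex
  generalize Nat.find hex = e at hle hmin hspec
  refine ⟨e, by omega, fun j hj h1 h2 => ?_⟩
  rcases lt_or_gt_of_ne h1 with hlt | hgt
  · obtain ⟨d, rfl⟩ : ∃ d, e = d + 1 := ⟨e - 1, by omega⟩
    have h3 := hmin d (by omega)
    push Not at h3
    have hr : t ≤ weightRatio n s t d := by
      rw [weightRatio_eq (by omega)]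
      nlinarith [h3.2]
    have hstep : ∀ k ≤ d, t * weight n s t k ≤ weight n s t (k + 1) := by
      intro k hk
      rw [weight_succ, mul_comm]
      exact mul_le_mul_of_nonneg_left (hr.trans (weightRatio_antitone n s ht hk)) (hw k)
    have hmono : ∀ k, j + 1 ≤ k → k ≤ d + 1 → weight n s t (j + 1) ≤ weight n s t k := by
      intro k hk
      induction k, hk using Nat.le_induction with
      | base => intro _; exact le_rfl
      | succ k hk ih =>
        intro h
        refine (ih (by omega)).trans (le_trans ?_ (hstep k (by omega)))
        exact le_mul_of_one_le_left (hw k) ht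
    linarith [hstep j (by omega), hmono (d + 1) (by omega) le_rfl, hw (d + 1 + 1)]
  · have hr : t * weightRatio n s t (e + 1) ≤ 1 := hspec.resolve_left (by omega)
    have hr1 : weightRatio n s t (e + 1) ≤ 1 :=
      (le_mul_of_one_le_left (weightRatio_nonneg ..) ht).trans hr
    have hmono : ∀ k, e + 2 ≤ k → weight n s t k ≤ weight n s t (e + 2) := by
      intro k hk
      induction k, hk using Nat.le_induction with
      | base => exact le_rfl
      | succ k hk ih =>
        rw [weight_succ]
        exact (mul_le_of_le_one_right (hw k)
          ((weightRatio_antitone n s ht (by omega)).trans hr1)).trans ih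
    have h4 : t * weight n s t (e + 2) ≤ weight n s t (e + 1) := by
      rw [weight_succ]
      calc t * (weight n s t (e + 1) * weightRatio n s t (e + 1))
          = weight n s t (e + 1) * (t * weightRatio n s t (e + 1)) := by ring
        _ ≤ _ := mul_le_of_le_one_right (hw _) hr
    have h5 := mul_le_mul_of_nonneg_left (hmono j (by omega)) (zero_le_one.trans ht)
    linarith [hw e]

theorem IsPolyFun3.weight (n j : ℕ) : IsPolyFun3 fun v => weight n v.1 v.2.1 j :=
  (snd.pow 2).mul (prod _ fun k => (fst.pow 2).mul (snd.pow (2 * (n - k))))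

/-- A finite set of reals cuts `[0, 1]` into consecutive intervals. -/
theorem exists_subdivision (F : Finset ℝ) :
    ∃ (n : ℕ) (θ : ℕ → ℝ), 0 < n ∧ θ 0 = 0 ∧ θ n = 1 ∧ (∀ j ≤ n, 0 ≤ θ j ∧ θ j ≤ 1) ∧
      ∀ j < n, θ j < θ (j + 1) ∧ ∀ x ∈ F, θ j < x → ¬ x < θ (j + 1) := by
  classical
  set G : Finset ℝ := insert 0 (insert 1 (F.filter fun x => 0 ≤ x ∧ x ≤ 1)) with hG
  have h0 : (0 : ℝ) ∈ G := by simp [hG]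
  have h1 : (1 : ℝ) ∈ G := by simp [hG]
  have hmem : ∀ x ∈ G, 0 ≤ x ∧ x ≤ 1 := by
    intro x hx
    simp only [hG, Finset.mem_insert, Finset.mem_filter] at hx
    rcases hx with rfl | rfl | hx
    · norm_num
    · norm_num
    · exact hx.2
  have hcard : 1 < G.card := Finset.one_lt_card.2 ⟨0, h0, 1, h1, zero_ne_one⟩
  obtain ⟨n, hn⟩ : ∃ n, G.card = n + 1 := ⟨G.card - 1, by omega⟩
  let φ := G.orderIsoOfFin hn
  let θ : ℕ → ℝ := fun j => if h : j < n + 1 then (φ ⟨j, h⟩ : ℝ) else 0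
  have hθ : ∀ (j) (h : j < n + 1), θ j = φ ⟨j, h⟩ := fun j h => dif_pos h
  have hsurj : ∀ x ∈ G, ∃ j, j < n + 1 ∧ θ j = x := by
    intro x hx
    refine ⟨φ.symm ⟨x, hx⟩, (φ.symm ⟨x, hx⟩).2, ?_⟩
    rw [hθ _ (φ.symm ⟨x, hx⟩).2]
    simp
  have hlt : ∀ i j, i < n + 1 → j < n + 1 → (θ i < θ j ↔ i < j) := by
    intro i j hi hj
    rw [hθ i hi, hθ j hj, Subtype.coe_lt_coe, φ.lt_iff_lt, Fin.mk_lt_mk]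
  have hθG : ∀ j, j < n + 1 → θ j ∈ G := fun j h => by rw [hθ j h]; exact (φ ⟨j, h⟩).2
  refine ⟨n, θ, by omega, ?_, ?_, fun j hj => hmem _ (hθG j (by omega)), fun j hj =>
    ⟨(hlt _ _ (by omega) (by omega)).2 (by omega), fun x hx hx1 hx2 => ?_⟩⟩
  · obtain ⟨k, hk, hk0⟩ := hsurj 0 h0
    refine le_antisymm ?_ (hmem _ (hθG 0 (by omega))).1
    rw [← hk0, ← not_lt, hlt _ _ hk (by omega)]
    omega
  · obtain ⟨k, hk, hk1⟩ := hsurj 1 h1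
    refine le_antisymm (hmem _ (hθG n (by omega))).2 ?_
    rw [← hk1, ← not_lt, hlt _ _ (by omega) hk]
    omega
  · have hxG : x ∈ G := by
      have ha := (hmem _ (hθG j (by omega))).1
      have hb := (hmem _ (hθG (j + 1) (by omega))).2
      simp only [hG, Finset.mem_insert, Finset.mem_filter]
      exact Or.inr (Or.inr ⟨hx, by linarith, by linarith⟩)
    obtain ⟨k, hk, rfl⟩ := hsurj x hxG
    rw [hlt _ _ (by omega) hk] at hx1
    rw [hlt _ _ hk (by omega)] at hx2
    omega

/-- The minimum of finitely many positive affine functions on `[0, 1]` is piecewise affine. -/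
theorem exists_affine_pieces {ι : Type*} [Finite ι] [Nonempty ι] (α β : ι → ℝ)
    (hα : ∀ i, 0 < α i) (hβ : ∀ i, 0 < β i) :
    ∃ (n : ℕ) (θ m : ℕ → ℝ), 0 < n ∧ θ 0 = 0 ∧ θ n = 1 ∧ (∀ j ≤ n, 0 ≤ θ j ∧ θ j ≤ 1) ∧
      (∀ j ≤ n, 0 < m j ∧ ∀ i, m j ≤ α i * θ j + β i * (1 - θ j)) ∧
      ∀ j < n, ∃ i, α i * θ j + β i * (1 - θ j) = m j ∧
        α i * θ (j + 1) + β i * (1 - θ (j + 1)) = m (j + 1) := by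
  classical
  have := Fintype.ofFinite ι
  obtain ⟨n, θ, hn, h0, h1, h01, hgap⟩ := exists_subdivision
    (Finset.univ.image fun ij : ι × ι =>
      (β ij.1 - β ij.2) / ((β ij.1 - β ij.2) - (α ij.1 - α ij.2)))
  have hmin : ∀ x : ℝ, ∃ i, ∀ i', α i * x + β i * (1 - x) ≤ α i' * x + β i' * (1 - x) :=
    fun x => Finite.exists_min fun i => α i * x + β i * (1 - x)
  choose c hc using hmin
  refine ⟨n, θ, fun j => α (c (θ j)) * θ j + β (c (θ j)) * (1 - θ j), hn, h0, h1, h01,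
    fun j hj => ⟨?_, fun i => hc _ i⟩, fun j hj => ?_⟩
  · obtain ⟨ha, hb⟩ := h01 j hj
    rcases ha.lt_or_eq with h | h
    · exact add_pos_of_pos_of_nonneg (mul_pos (hα _) h) (mul_nonneg (hβ _).le (by linarith))
    · simpa [← h] using hβ _
  · obtain ⟨hlt, hno⟩ := hgap j hj
    -- two of the affine functions cannot cross strictly inside the interval
    have hcross : ∀ a b : ι, ∀ x y, (x = θ j ∧ y = θ (j + 1) ∨ x = θ (j + 1) ∧ y = θ j) →
        α a * x + β a * (1 - x) < α b * x + β b * (1 - x) →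
        ¬ α b * y + β b * (1 - y) < α a * y + β a * (1 - y) := by
      intro a b x y hxy hx hy
      set D := (β a - β b) - (α a - α b) with hD
      have hx' : β a - β b < D * x := by rw [hD]; linarith
      have hy' : D * y < β a - β b := by rw [hD]; linarith
      have hmem := hno ((β a - β b) / D) (Finset.mem_image.2 ⟨(a, b), Finset.mem_univ _, rfl⟩)
      have hDne : D * (x - y) > 0 := by linarith
      rcases hxy with ⟨rfl, rfl⟩ | ⟨rfl, rfl⟩
      · have hDneg : D < 0 := by nlinarith
        exact hmem (by rw [lt_div_iff_of_neg hDneg]; linarith)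
          (by rw [div_lt_iff_of_neg hDneg]; linarith)
      · have hDpos : 0 < D := by nlinarith
        exact hmem (by rw [lt_div_iff₀ hDpos]; linarith)
          (by rw [div_lt_iff₀ hDpos]; linarith)
    have hmid := hc ((θ j + θ (j + 1)) / 2)
    refine ⟨c ((θ j + θ (j + 1)) / 2), le_antisymm ?_ (hc _ _), le_antisymm ?_ (hc _ _)⟩
    · by_contra! hcon
      exact hcross _ _ _ _ (Or.inl ⟨rfl, rfl⟩) hcon (by linarith [hmid (c (θ j))])
    · by_contra! hcon
      exact hcross _ _ _ _ (Or.inr ⟨rfl, rfl⟩) hcon (by linarith [hmid (c (θ (j + 1)))])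

/-- The weighted combination of the points `(θ j, 1 - θ j)` takes on all directions of the
open quadrant as `s` varies. -/
theorem exists_weight_parallel {n : ℕ} (hn : 0 < n) {θ : ℕ → ℝ} (h0 : θ 0 = 0) (h1 : θ n = 1)
    (h01 : ∀ j ≤ n, 0 ≤ θ j ∧ θ j ≤ 1) {K t x y : ℝ} (hK : 0 < K) (ht : 1 ≤ t)
    (hx : 0 < x) (hy : 0 < y) (htK : K * y ≤ t * x) :
    ∃ s, (K + ∑ j ∈ Finset.range (n + 1), weight n s t j * θ j) * y =
      (K + ∑ j ∈ Finset.range (n + 1), weight n s t j * (1 - θ j)) * x := by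
  set h : ℝ → ℝ := fun s => (K + ∑ j ∈ Finset.range (n + 1), weight n s t j * θ j) * y -
      (K + ∑ j ∈ Finset.range (n + 1), weight n s t j * (1 - θ j)) * x with hh
  have hcont : Continuous h := by
    unfold h weight weightRatio
    fun_prop
  have hneg : h 0 ≤ 0 := by
    have hz : ∀ j, weight n 0 t (j + 1) = 0 := fun j => by
      rw [weight_succ]; simp [weightRatio]
    simp only [hh, Finset.sum_range_succ', hz, weight_zero, h0]
    simp only [zero_mul, Finset.sum_const_zero, mul_zero, zero_add, sub_zero, mul_one]
    have htt : t * x ≤ t ^ 2 * x := by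
      gcongr
      nlinarith
    nlinarith [mul_pos hK hx]
  have hpos : ∃ s, 0 ≤ s ∧ 0 ≤ h s := by
    obtain ⟨d, rfl⟩ : ∃ d, n = d + 1 := ⟨n - 1, by omega⟩
    set s := 1 + (d + 1 + K) * x / y with hs
    have hs1 : 1 ≤ s := by
      have : 0 ≤ (d + 1 + K) * x / y := by positivity
      linarith
    have hsy : (d + 1 + K) * x ≤ s * y := by
      have := div_mul_cancel₀ ((d + 1 + K) * x) hy.ne'
      rw [hs, add_mul (1 : ℝ), this]
      linarith
    have hw := weight_nonneg (d + 1) s t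
    have hratio : ∀ k, 1 ≤ weightRatio (d + 1) s t k := fun k =>
      one_le_mul_of_one_le_of_one_le (one_le_pow₀ hs1) (one_le_pow₀ ht)
    have hmono : Monotone (weight (d + 1) s t) := monotone_nat_of_le_succ fun j => by
      rw [weight_succ]; exact le_mul_of_one_le_right (hw j) (hratio j)
    have hd1 : 1 ≤ weight (d + 1) s t d :=
      le_trans (by rw [weight_zero]; exact one_le_pow₀ ht) (hmono (Nat.zero_le d))
    have hlast : s * weight (d + 1) s t d ≤ weight (d + 1) s t (d + 1) := by
      rw [weight_succ, mul_comm]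
      refine mul_le_mul_of_nonneg_left ?_ (hw d)
      calc s ≤ s ^ 2 := by nlinarith
        _ ≤ _ := le_mul_of_one_le_right (sq_nonneg s) (one_le_pow₀ ht)
    have hsum1 : weight (d + 1) s t (d + 1) ≤
        ∑ j ∈ Finset.range (d + 1 + 1), weight (d + 1) s t j * θ j := by
      rw [Finset.sum_range_succ, h1, mul_one]
      have : 0 ≤ ∑ j ∈ Finset.range (d + 1), weight (d + 1) s t j * θ j :=
        Finset.sum_nonneg fun j hj => mul_nonneg (hw j)
          (h01 j (Finset.mem_range.1 hj).le).1
      linarith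
    have hsum2 : ∑ j ∈ Finset.range (d + 1 + 1), weight (d + 1) s t j * (1 - θ j) ≤
        (d + 1) * weight (d + 1) s t d := by
      rw [Finset.sum_range_succ, h1, sub_self, mul_zero, add_zero]
      calc _ ≤ ∑ j ∈ Finset.range (d + 1), weight (d + 1) s t d := by
            refine Finset.sum_le_sum fun j hj => ?_
            have hj' := Finset.mem_range.1 hj
            exact (mul_le_of_le_one_right (hw j) (by linarith [(h01 j hj'.le).1])).trans
              (hmono (by omega))
        _ = _ := by simp
    refine ⟨s, by linarith, sub_nonneg.2 ?_⟩
    set W := weight (d + 1) s t d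
    calc _ ≤ (K * W + (d + 1) * W) * x := by
          gcongr
          exact le_mul_of_one_le_right hK.le hd1
      _ = W * ((d + 1 + K) * x) := by ring
      _ ≤ W * (s * y) := by gcongr
      _ = s * W * y := by ring
      _ ≤ _ := by
          gcongr
          linarith
  obtain ⟨s, hs0, hs⟩ := hpos
  obtain ⟨r, -, hr⟩ := intermediate_value_Icc hs0 hcont.continuousOn ⟨hneg, hs⟩
  exact ⟨r, sub_eq_zero.1 hr⟩

theorem exists_isPolyMap3_range_of_nonempty {ι : Type*} [Finite ι] [Nonempty ι] (α β : ι → ℝ)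
    (hα : ∀ i, 0 < α i) (hβ : ∀ i, 0 < β i) :
    ∃ f, IsPolyMap3 f ∧
      Set.range f = {p : ℝ × ℝ | 0 < p.1 ∧ 0 < p.2 ∧ ∀ i, 1 < α i * p.1 + β i * p.2} := by
  have := Fintype.ofFinite ι
  obtain ⟨n, θ, m, hn, h0, h1, h01, hm, hpiece⟩ := exists_affine_pieces α β hα hβ
  obtain ⟨K, hK, hK1⟩ : ∃ K : ℝ, 0 < K ∧ ∀ i, 1 < K * (α i + β i) := by
    have h : ∀ᶠ K : ℝ in Filter.atTop, 0 < K ∧ ∀ i, 1 < K * (α i + β i) :=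
      (Filter.eventually_gt_atTop 0).and (Filter.eventually_all.2 fun i =>
        (Filter.tendsto_id.atTop_mul_const (add_pos (hα i) (hβ i))).eventually_gt_atTop 1)
    exact h.exists
  let N₁ : ℝ → ℝ → ℝ := fun s t => K + ∑ j ∈ Finset.range (n + 1), weight n s t j * θ j
  let N₂ : ℝ → ℝ → ℝ := fun s t => K + ∑ j ∈ Finset.range (n + 1), weight n s t j * (1 - θ j)
  let E : ℝ → ℝ → ℝ := fun s t => ∑ j ∈ Finset.range (n + 1), weight n s t j * m j
  have hj : ∀ {j}, j ∈ Finset.range (n + 1) → j ≤ n := fun h =>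
    Nat.lt_succ_iff.1 (Finset.mem_range.1 h)
  have hw := weight_nonneg n
  have hE : ∀ s t, 0 ≤ E s t := fun s t => Finset.sum_nonneg fun j h =>
    mul_nonneg (hw s t j) (hm j (hj h)).1.le
  have hN₁ : ∀ s t, 0 < N₁ s t := fun s t => add_pos_of_pos_of_nonneg hK <|
    Finset.sum_nonneg fun j h => mul_nonneg (hw s t j) (h01 j (hj h)).1
  have hN₂ : ∀ s t, 0 < N₂ s t := fun s t => add_pos_of_pos_of_nonneg hK <|
    Finset.sum_nonneg fun j h => mul_nonneg (hw s t j) (by linarith [(h01 j (hj h)).2])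
  have hL : ∀ s t i, α i * N₁ s t + β i * N₂ s t = K * (α i + β i) + (E s t +
      ∑ j ∈ Finset.range (n + 1), weight n s t j * (α i * θ j + β i * (1 - θ j) - m j)) := by
    intro s t i
    simp only [N₁, N₂, E, mul_add, Finset.mul_sum]
    rw [← Finset.sum_add_distrib, add_add_add_comm, ← Finset.sum_add_distrib]
    congr 1
    · ring
    · exact Finset.sum_congr rfl fun j _ => by ring
  have hEpoly : IsPolyFun3 fun v => E v.1 v.2.1 :=
    .sum _ fun j => (IsPolyFun3.weight n j).mul (.const _)
  have hr := hEpoly.recipBound .trd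
  refine ⟨fun v => (recipBound (E v.1 v.2.1) v.2.2 * N₁ v.1 v.2.1,
      recipBound (E v.1 v.2.1) v.2.2 * N₂ v.1 v.2.1),
    (hr.mul ((IsPolyFun3.const K).add
      (.sum _ fun j => (IsPolyFun3.weight n j).mul (.const _)))).isPolyMap3
    (hr.mul ((IsPolyFun3.const K).add
      (.sum _ fun j => (IsPolyFun3.weight n j).mul (.const _)))), Set.Subset.antisymm ?_ ?_⟩
  · rintro _ ⟨⟨s, t, x⟩, rfl⟩
    have h2 := one_le_recipBound_mul (hE s t) x
    have h3 : 0 < recipBound (E s t) x :=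
      pos_of_mul_pos_left (one_pos.trans_le h2) (by linarith [hE s t])
    refine ⟨mul_pos h3 (hN₁ s t), mul_pos h3 (hN₂ s t), fun i => ?_⟩
    have h4 : 0 ≤ ∑ j ∈ Finset.range (n + 1),
        weight n s t j * (α i * θ j + β i * (1 - θ j) - m j) :=
      Finset.sum_nonneg fun j h => mul_nonneg (hw s t j) (sub_nonneg.2 ((hm j (hj h)).2 i))
    have h5 : 1 + E s t < α i * N₁ s t + β i * N₂ s t := by
      rw [hL]; linarith [hK1 i]
    calc 1 ≤ recipBound (E s t) x * (1 + E s t) := h2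
      _ < recipBound (E s t) x * (α i * N₁ s t + β i * N₂ s t) := by gcongr
      _ = _ := by ring
  · rintro ⟨x, y⟩ ⟨hx, hy, hq⟩
    simp only at hx hy hq
    obtain ⟨δ, hδ, hδq⟩ : ∃ δ > 0, ∀ i, 1 + δ ≤ α i * x + β i * y := by
      obtain ⟨i, hi⟩ := Finite.exists_min fun i => α i * x + β i * y
      exact ⟨α i * x + β i * y - 1, by linarith [hq i], fun k => by linarith [hi k]⟩
    obtain ⟨M, hM, hM0⟩ : ∃ M, (∀ i, α i + β i ≤ M) ∧ 0 < M := by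
      obtain ⟨i, hi⟩ := Finite.exists_max fun i => α i + β i
      exact ⟨_, hi, add_pos (hα i) (hβ i)⟩
    obtain ⟨c, hc, hcm⟩ : ∃ c > 0, ∀ j ≤ n, c ≤ m j := by
      obtain ⟨k, hk, hmin⟩ := Finset.exists_min_image (Finset.range (n + 1)) m ⟨0, by simp⟩
      exact ⟨m k, (hm k (hj hk)).1, fun j h => hmin j (Finset.mem_range.2 (by omega))⟩
    set G := (n + 1) * M * (2 / c) with hG
    obtain ⟨t, ht1, htx, htG, htC⟩ : ∃ t : ℝ, 1 ≤ t ∧ K * y ≤ t * x ∧ 2 * G ≤ t * δ ∧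
        2 * (K * M) ≤ t * (δ * c) := by
      have hlin : ∀ a b : ℝ, 0 < b → ∀ᶠ t : ℝ in Filter.atTop, a ≤ t * b := fun a b hb =>
        (Filter.tendsto_id.atTop_mul_const hb).eventually_ge_atTop a
      exact ((Filter.eventually_ge_atTop 1).and ((hlin _ _ hx).and ((hlin _ _ hδ).and
        (hlin _ _ (mul_pos hδ hc))))).exists
    have ht0 : 0 < t := by linarith
    obtain ⟨s, hs⟩ := exists_weight_parallel hn h0 h1 h01 hK ht1 hx hy htx
    change N₁ s t * y = N₂ s t * x at hs
    have hbE : ∀ j ≤ n, weight n s t j * c ≤ E s t := fun j h =>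
      (mul_le_mul_of_nonneg_left (hcm j h) (hw s t j)).trans
        (Finset.single_le_sum (f := fun j => weight n s t j * m j)
          (fun k hk => mul_nonneg (hw s t k) (hm k (hj hk)).1.le)
          (Finset.mem_range.2 (by omega)))
    have htE : t * c ≤ E s t := by
      refine le_trans ?_ (hbE 0 (Nat.zero_le n))
      rw [weight_zero]
      gcongr
      nlinarith
    have hEpos : 0 < E s t := (mul_pos ht0 hc).trans_le htE
    obtain ⟨e, he, hdom⟩ := exists_weight_dominant hn s ht1
    obtain ⟨i, hi0, hi1⟩ := hpiece e he
    have herr : ∑ j ∈ Finset.range (n + 1),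
        weight n s t j * (α i * θ j + β i * (1 - θ j) - m j) ≤ G * E s t / t := by
      have hterm : ∀ j ∈ Finset.range (n + 1),
          weight n s t j * (α i * θ j + β i * (1 - θ j) - m j) ≤ M * (2 / c) * E s t / t := by
        intro j hjm
        have hnn : 0 ≤ M * (2 / c) * E s t / t := by positivity
        by_cases hje : j = e
        · subst hje; simpa [hi0] using hnn
        by_cases hje' : j = e + 1
        · subst hje'; simpa [hi1] using hnn
        have hval : α i * θ j + β i * (1 - θ j) - m j ≤ M := by
          have hjb := h01 j (hj hjm)
          have hmj := (hm j (hj hjm)).1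
          nlinarith [hM i, mul_nonneg (hα i).le (sub_nonneg.2 hjb.2),
            mul_nonneg (hβ i).le hjb.1]
        have hwj : weight n s t j ≤ 2 / c * E s t / t := by
          rw [le_div_iff₀ ht0, div_mul_eq_mul_div, le_div_iff₀ hc]
          have := mul_le_mul_of_nonneg_right (hdom j (hj hjm) hje hje') hc.le
          linarith [hbE e he.le, hbE (e + 1) he]
        calc _ ≤ weight n s t j * M := mul_le_mul_of_nonneg_left hval (hw s t j)
          _ ≤ (2 / c * E s t / t) * M := mul_le_mul_of_nonneg_right hwj hM0.le
          _ = _ := by ring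
      refine (Finset.sum_le_sum hterm).trans_eq ?_
      simp only [Finset.sum_const, Finset.card_range, nsmul_eq_mul, hG]
      push_cast
      ring
    have hGE : G * E s t / t ≤ δ / 2 * E s t := by
      rw [div_le_iff₀ ht0]
      nlinarith
    have hKM : K * (α i + β i) ≤ δ / 2 * E s t := by
      have h2 : K * (α i + β i) ≤ K * M := by gcongr; exact hM i
      nlinarith
    have hLle : α i * N₁ s t + β i * N₂ s t ≤ (1 + δ) * E s t := by
      rw [hL]; linarith
    have hμ : 0 < N₁ s t / x := div_pos (hN₁ s t) hx
    have hμ1 : N₁ s t = N₁ s t / x * x := by field_simp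
    have hμ2 : N₂ s t = N₁ s t / x * y := by field_simp; linarith
    set μ := N₁ s t / x
    have hμE : μ ≤ E s t := by
      have h6 : μ * (1 + δ) ≤ (1 + δ) * E s t := by
        refine le_trans (mul_le_mul_of_nonneg_left (hδq i) hμ.le) (le_trans (le_of_eq ?_) hLle)
        rw [hμ1, hμ2]; ring
      nlinarith
    obtain ⟨z, hz⟩ := exists_recipBound_eq (ρ := μ⁻¹) hEpos (by
      rw [inv_mul_eq_div, one_le_div hμ]; linarith)
    refine ⟨(s, t, z), ?_⟩
    simp only [hz]
    rw [hμ1, hμ2, inv_mul_cancel_left₀ hμ.ne', inv_mul_cancel_left₀ hμ.ne']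

theorem exists_isPolyMap3_range {ι : Type*} [Finite ι] (α β k : ι → ℝ)
    (hα : ∀ i, 0 ≤ α i) (hβ : ∀ i, 0 ≤ β i) (hne : ∀ i, 0 < α i ∨ 0 < β i)
    (hk : ∀ i, 0 < k i → 0 < α i ∧ 0 < β i) :
    ∃ f, IsPolyMap3 f ∧
      Set.range f = {p : ℝ × ℝ | 0 < p.1 ∧ 0 < p.2 ∧ ∀ i, k i < α i * p.1 + β i * p.2} := by
  have hred : ∀ p : ℝ × ℝ, 0 < p.1 → 0 < p.2 → ∀ i, k i ≤ 0 → k i < α i * p.1 + β i * p.2 := by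
    intro p h1 h2 i hi
    refine hi.trans_lt ?_
    rcases hne i with h | h
    · exact add_pos_of_pos_of_nonneg (mul_pos h h1) (mul_nonneg (hβ i) h2.le)
    · exact add_pos_of_nonneg_of_pos (mul_nonneg (hα i) h1.le) (mul_pos h h2)
  by_cases hJ : Nonempty {i // 0 < k i}
  · obtain ⟨f, hf, hrange⟩ := exists_isPolyMap3_range_of_nonempty
      (fun i : {i // 0 < k i} => α i / k i) (fun i => β i / k i)
      (fun i => div_pos (hk i i.2).1 i.2) (fun i => div_pos (hk i i.2).2 i.2)
    refine ⟨f, hf, hrange.trans (Set.ext fun p => ?_)⟩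
    have hiff : ∀ i : {i // 0 < k i}, 1 < α i / k i * p.1 + β i / k i * p.2 ↔
        k i < α i * p.1 + β i * p.2 := fun i => by
      rw [div_mul_eq_mul_div, div_mul_eq_mul_div, ← add_div, one_lt_div i.2]
    refine and_congr_right fun h1 => and_congr_right fun h2 => ⟨fun h i => ?_, fun h i => ?_⟩
    · by_cases hi : 0 < k i
      · exact (hiff ⟨i, hi⟩).1 (h ⟨i, hi⟩)
      · exact hred p h1 h2 i (not_lt.1 hi)
    · exact (hiff i).2 (h i)
  · obtain ⟨f, hf, hrange⟩ := exists_isPolyMap3_range_quadrant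
    refine ⟨f, hf, hrange.trans (Set.ext fun p => ?_)⟩
    exact ⟨fun h => ⟨h.1, h.2, fun i => hred p h.1 h.2 i (not_lt.1 fun hi => hJ ⟨i, hi⟩)⟩,
      fun h => ⟨h.1, h.2.1⟩⟩

theorem interior_setOf_forall_nonneg {ι : Type*} [Finite ι] (a b c : ι → ℝ)
    (hab : ∀ i, (a i, b i) ≠ (0, 0)) :
    interior {p : ℝ × ℝ | ∀ i, 0 ≤ a i * p.1 + b i * p.2 + c i} =
      {p | ∀ i, 0 < a i * p.1 + b i * p.2 + c i} := by
  refine Set.Subset.antisymm (fun p hp i => ?_) (interior_maximal (fun p hp i => (hp i).le) ?_)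
  · have hcont : Filter.Tendsto (fun t : ℝ => (p.1 - t * a i, p.2 - t * b i))
        (nhdsWithin 0 (Set.Ioi 0)) (nhds p) := by
      have : Continuous fun t : ℝ => (p.1 - t * a i, p.2 - t * b i) := by fun_prop
      simpa using (this.tendsto 0).mono_left nhdsWithin_le_nhds
    obtain ⟨t, ht, ht0⟩ := ((hcont.eventually (mem_interior_iff_mem_nhds.1 hp)).and
      self_mem_nhdsWithin).exists
    have h1 := ht i
    simp only at h1
    have h2 : 0 < a i ^ 2 + b i ^ 2 := by
      by_contra! h
      refine hab i (Prod.ext ?_ ?_) <;> simp only <;> nlinarith [sq_nonneg (a i), sq_nonneg (b i)]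
    nlinarith [mul_pos (Set.mem_Ioi.1 ht0) h2]
  · simp only [Set.ofPred_forall]
    exact isOpen_iInter_of_finite fun i => isOpen_lt (by fun_prop) (by fun_prop)

theorem nonneg_of_forall_nonneg_add_mul {c A : ℝ} (h : ∀ t : ℝ, 0 ≤ t → 0 ≤ c + t * A) :
    0 ≤ A := by
  by_contra! hA
  have h1 := h ((|c| + 1) / -A) (div_nonneg (by positivity) (by linarith))
  have h2 : (|c| + 1) / -A * A = -(|c| + 1) := by
    rw [div_neg, neg_mul, div_mul_cancel₀ _ hA.ne]
  linarith [le_abs_self c]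

/-- If the recession directions of a family of half-planes do not extend beyond `w`, then one of
the half-planes is parallel to `w`. -/
theorem exists_eq_zero_of_recession {ι : Type*} [Finite ι] {A B : ι → ℝ}
    (hB : ∀ i, 0 ≤ B i) (h : ∀ δ > 0, ¬ ∀ i, 0 ≤ B i - δ * A i) : ∃ i, B i = 0 := by
  by_contra! hcon
  have hev : ∀ᶠ δ : ℝ in nhdsWithin 0 (Set.Ioi 0), ∀ i, 0 < B i - δ * A i := by
    refine Filter.eventually_all.2 fun i => ?_
    have hc : Continuous fun δ : ℝ => B i - δ * A i := by fun_prop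
    refine ((hc.tendsto 0).mono_left nhdsWithin_le_nhds).eventually_const_lt ?_
    simpa using (hB i).lt_of_ne' (hcon i)
  obtain ⟨δ, h1, h2⟩ := (hev.and self_mem_nhdsWithin).exists
  exact h δ h2 fun i => (h1 i).le

theorem exists_sharp_bound {ι : Type*} [Finite ι] {A B : ι → ℝ} (c : ι → ℝ) (hA : ∀ i, 0 ≤ A i)
    (hne : ∀ i, A i ≠ 0 ∨ B i ≠ 0) (h : ∃ i, B i = 0) :
    ∃ x₀, (∃ i, 0 < A i ∧ B i = 0 ∧ A i * x₀ + c i = 0) ∧ ∀ i, B i = 0 → 0 ≤ A i * x₀ + c i := by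
  have hpos : ∀ i, B i = 0 → 0 < A i := fun i hi =>
    (hA i).lt_of_ne' ((hne i).resolve_right fun h => h hi)
  have : Nonempty {i // B i = 0} := nonempty_subtype.2 h
  obtain ⟨⟨i, hi⟩, hmax⟩ := Finite.exists_max fun i : {i // B i = 0} => -c i / A i
  refine ⟨-c i / A i, ⟨i, hpos i hi, hi, ?_⟩, fun k hk => ?_⟩
  · rw [mul_div_cancel₀ _ (hpos i hi).ne']; ring
  · have := hmax ⟨k, hk⟩
    simp only at this
    rw [div_le_iff₀ (hpos k hk)] at this
    linarith

theorem stmt_9 (P : Set (ℝ × ℝ)) (hP : IsVPolygon P) :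
    ∃ f : ℝ × ℝ × ℝ → ℝ × ℝ, IsPolyMap3 f ∧ Set.range f = interior P := by
  obtain ⟨⟨n, a, b, c, hab, rfl⟩, hint, v, w, hvw, hrec⟩ := hP
  obtain ⟨p₀, hp₀⟩ := hint.mono interior_subset
  rw [interior_setOf_forall_nonneg a b c hab]
  set A : Fin n → ℝ := fun i => a i * v.1 + b i * v.2 with hAdef
  set B : Fin n → ℝ := fun i => a i * w.1 + b i * w.2 with hBdef
  have hpair := LinearIndependent.pair_iff.1 hvw
  have hdet : v.1 * w.2 - v.2 * w.1 ≠ 0 := by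
    intro hd
    have e1 := hpair w.2 (-v.2) (Prod.ext (by simp; linarith) (by simp; ring))
    have e2 := hpair w.1 (-v.1) (Prod.ext (by simp; ring) (by simp; linarith))
    have hw : w = 0 := Prod.ext e2.1 e1.1
    have := (hpair 0 1 (by simp [hw])).2
    norm_num at this
  have hdir : ∀ d : ℝ × ℝ, d ∈ recessionCone {p | ∀ i, 0 ≤ a i * p.1 + b i * p.2 + c i} →
      ∀ i, 0 ≤ a i * d.1 + b i * d.2 := by
    intro d hd i
    refine nonneg_of_forall_nonneg_add_mul (c := a i * p₀.1 + b i * p₀.2 + c i) fun t ht => ?_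
    have := hd p₀ hp₀ t ht i
    simp only [Prod.fst_add, Prod.snd_add, Prod.smul_fst, Prod.smul_snd, smul_eq_mul] at this
    linarith
  have hmem : ∀ d : ℝ × ℝ, (∀ i, 0 ≤ a i * d.1 + b i * d.2) →
      ∃ s t : ℝ, 0 ≤ s ∧ 0 ≤ t ∧ d = s • v + t • w := by
    intro d hd
    have : d ∈ recessionCone {p | ∀ i, 0 ≤ a i * p.1 + b i * p.2 + c i} := by
      intro p hp t ht i
      simp only [Prod.fst_add, Prod.snd_add, Prod.smul_fst, Prod.smul_snd, smul_eq_mul]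
      nlinarith [hp i, mul_nonneg ht (hd i)]
    rwa [hrec] at this
  have hA : ∀ i, 0 ≤ A i := hdir v (by rw [hrec]; exact ⟨1, 0, by simp⟩)
  have hB : ∀ i, 0 ≤ B i := hdir w (by rw [hrec]; exact ⟨0, 1, by simp⟩)
  have hne : ∀ i, A i ≠ 0 ∨ B i ≠ 0 := by
    intro i
    by_contra! h
    obtain ⟨h1, h2⟩ := h
    simp only [hAdef, hBdef] at h1 h2
    refine hab i (Prod.ext ?_ ?_)
    · exact (mul_eq_zero.1 (show a i * (v.1 * w.2 - v.2 * w.1) = 0 by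
        linear_combination w.2 * h1 - v.2 * h2)).resolve_right hdet
    · exact (mul_eq_zero.1 (show b i * (v.1 * w.2 - v.2 * w.1) = 0 by
        linear_combination v.1 * h2 - w.1 * h1)).resolve_right hdet
  have hB0 : ∃ i, B i = 0 := by
    refine exists_eq_zero_of_recession (A := A) hB fun δ hδ h => ?_
    obtain ⟨s, t, hs, ht, hd⟩ := hmem (w - δ • v) fun i => by
      have := h i
      simp only [hAdef, hBdef] at this
      simp only [Prod.fst_sub, Prod.snd_sub, Prod.smul_fst, Prod.smul_snd, smul_eq_mul]
      linarith
    have := (hpair (s + δ) (t - 1) (by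
      rw [← sub_eq_zero.2 hd.symm]; module)).1
    linarith
  have hA0 : ∃ i, A i = 0 := by
    refine exists_eq_zero_of_recession (A := B) hA fun δ hδ h => ?_
    obtain ⟨s, t, hs, ht, hd⟩ := hmem (v - δ • w) fun i => by
      have := h i
      simp only [hAdef, hBdef] at this
      simp only [Prod.fst_sub, Prod.snd_sub, Prod.smul_fst, Prod.smul_snd, smul_eq_mul]
      linarith
    have := (hpair (s - 1) (t + δ) (by
      rw [← sub_eq_zero.2 hd.symm]; module)).2
    linarith
  obtain ⟨x₀, ⟨i₁, hAi₁, hBi₁, hi₁⟩, hx₀⟩ := exists_sharp_bound c hA hne hB0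
  obtain ⟨y₀, ⟨i₂, hBi₂, hAi₂, hi₂⟩, hy₀⟩ := exists_sharp_bound c hB (fun i => (hne i).symm) hA0
  obtain ⟨f, hf, hrange⟩ := exists_isPolyMap3_range A B (fun i => -(A i * x₀ + B i * y₀ + c i))
    hA hB (fun i => (hne i).imp (hA i).lt_of_ne' (hB i).lt_of_ne') (by
      intro i hi
      refine ⟨(hA i).lt_of_ne' fun h => ?_, (hB i).lt_of_ne' fun h => ?_⟩
      · rw [h] at hi; linarith [hy₀ i h]
      · rw [h] at hi; linarith [hx₀ i h])
  have hval : ∀ x y i, a i * ((x₀ + x) * v.1 + (y₀ + y) * w.1) +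
      b i * ((x₀ + x) * v.2 + (y₀ + y) * w.2) + c i =
      A i * x + B i * y + (A i * x₀ + B i * y₀ + c i) := by
    intro x y i
    simp only [hAdef, hBdef]
    ring
  have hX := (IsPolyFun3.const x₀).add hf.isPolyFun3_fst
  have hY := (IsPolyFun3.const y₀).add hf.isPolyFun3_snd
  refine ⟨fun u => ((x₀ + (f u).1) * v.1 + (y₀ + (f u).2) * w.1,
      (x₀ + (f u).1) * v.2 + (y₀ + (f u).2) * w.2),
    ((hX.mul (.const _)).add (hY.mul (.const _))).isPolyMap3
      ((hX.mul (.const _)).add (hY.mul (.const _))), Set.Subset.antisymm ?_ ?_⟩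
  · rintro _ ⟨u, rfl⟩ i
    have hu : f u ∈ Set.range f := ⟨u, rfl⟩
    rw [hrange] at hu
    simp only [hval]
    linarith [hu.2.2 i]
  · rintro ⟨p, q⟩ hp
    obtain ⟨x, y, hpx, hqy⟩ : ∃ x y, p = (x₀ + x) * v.1 + (y₀ + y) * w.1 ∧
        q = (x₀ + x) * v.2 + (y₀ + y) * w.2 := by
      refine ⟨(p * w.2 - q * w.1) / (v.1 * w.2 - v.2 * w.1) - x₀,
        (v.1 * q - v.2 * p) / (v.1 * w.2 - v.2 * w.1) - y₀, ?_, ?_⟩ <;>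
      · rw [add_sub_cancel, add_sub_cancel, div_mul_eq_mul_div, div_mul_eq_mul_div, ← add_div,
          eq_div_iff hdet]
        ring
    subst hpx hqy
    have hpos : ∀ i, 0 < A i * x + B i * y + (A i * x₀ + B i * y₀ + c i) := fun i => by
      rw [← hval]; exact hp i
    have hxy : (x, y) ∈ Set.range f := by
      rw [hrange]
      refine ⟨?_, ?_, fun i => by linarith [hpos i]⟩
      · have := hpos i₁
        rw [hBi₁] at this
        exact pos_of_mul_pos_right (show 0 < A i₁ * x by linarith) hAi₁.le
      · have := hpos i₂
        rw [hAi₂] at this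
        exact pos_of_mul_pos_right (show 0 < B i₂ * y by linarith) hBi₂.le
    obtain ⟨u, hu⟩ := hxy
    exact ⟨u, by simp only [hu]⟩
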